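/- arXiv:1010.5719 — 2 statements merged into one kernel-verified Lean document; each statement's English description precedes it below -/
import Mathlib

section
/- Let π̃ = (π_t, π_b) be a labeled permutation on an alphabet 𝒜 of cardinality d ≥ 2 with π_t⁻¹(d) ≠ π_b⁻¹(d), let λ ∈ ℝ^𝒜 have all coordinates positive, and let T = T(π̃, λ) be the associated interval exchange transformation on I = [0, L), L = Σ_α λ_α. Suppose T has type t, i.e. λ_{π_t⁻¹(d)} > λ_{π_b⁻¹(d)}, and set J = [0, L − λ_{π_b⁻¹(d)}). Define λ′ ∈ ℝ^𝒜 by λ′_{π_t⁻¹(d)} = λ_{π_t⁻¹(d)} − λ_{π_b⁻¹(d)} and λ′_α = λ_α for α ≠ π_t⁻¹(d). Then for every x ∈ J outside a finite subset of J, there is a least integer m ≥ 1 with T^m(x) ∈ J (in fact m ∈ {1, 2}), and this first return satisfies T^m(x) = T(𝓡_t(π̃), λ′)(x); i.e. the first return map of T to J coincides, off a finite set, with the interval exchange transformation associated to (𝓡_t(π̃), λ′). The symmetric statement holds when T has type b, i.e. λ_{π_t⁻¹(d)} < λ_{π_b⁻¹(d)}: with J = [0, L − λ_{π_t⁻¹(d)})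 and λ′ obtained by replacing λ_{π_b⁻¹(d)} with λ_{π_b⁻¹(d)} − λ_{π_t⁻¹(d)}, the first return map of T to J coincides, off a finite set, with T(𝓡_b(π̃), λ′). -/
/-!
A labeled permutation on a finite alphabet `A` with `|A| = d` is a pair of bijections
`A ≃ Fin d` (positions encoded 0-based).  The labeled Rauzy moves are encoded as
binary relations.  Given positive lengths `λ : A → ℝ`, the associated interval exchange
transformation acts on `I = [0, Σ λ)` by `x ↦ x - x^t_a + x^b_a` on the interval
`[x^t_a, x^t_a + λ_a)`, where `x^t_a = Σ_{π_t(b) < π_t(a)} λ_b` and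
`x^b_a = Σ_{π_b(b) < π_b(a)} λ_b`.
-/

/-- The labeled top Rauzy move `𝓡_t`, as a relation. -/
def labStepT {A : Type*} {d : ℕ} (p p' : (A ≃ Fin d) × (A ≃ Fin d)) : Prop :=
  ∀ last : Fin d, (last : ℕ) + 1 = d →
    p.1.symm last ≠ p.2.symm last ∧ p'.1 = p.1 ∧
    ∀ j : Fin d,
      ((j : ℕ) ≤ (p.2 (p.1.symm last) : ℕ) → p'.2.symm j = p.2.symm j) ∧
      ((j : ℕ) = (p.2 (p.1.symm last) : ℕ) + 1 → p'.2.symm j = p.2.symm last) ∧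
      ((p.2 (p.1.symm last) : ℕ) + 1 < (j : ℕ) →
        ∀ i : Fin d, (i : ℕ) + 1 = (j : ℕ) → p'.2.symm j = p.2.symm i)

/-- The labeled bottom Rauzy move `𝓡_b`, as a relation. -/
def labStepB {A : Type*} {d : ℕ} (p p' : (A ≃ Fin d) × (A ≃ Fin d)) : Prop :=
  ∀ last : Fin d, (last : ℕ) + 1 = d →
    p.1.symm last ≠ p.2.symm last ∧ p'.2 = p.2 ∧
    ∀ j : Fin d,
      ((j : ℕ) ≤ (p.1 (p.2.symm last) : ℕ) → p'.1.symm j = p.1.symm j) ∧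
      ((j : ℕ) = (p.1 (p.2.symm last) : ℕ) + 1 → p'.1.symm j = p.1.symm last) ∧
      ((p.1 (p.2.symm last) : ℕ) + 1 < (j : ℕ) →
        ∀ i : Fin d, (i : ℕ) + 1 = (j : ℕ) → p'.1.symm j = p.1.symm i)

/-- `x^t_a`: the left endpoint of the interval of the letter `a` before the exchange. -/
def leftTop {A : Type*} [Fintype A] {d : ℕ} (p : (A ≃ Fin d) × (A ≃ Fin d))
    (lam : A → ℝ) (a : A) : ℝ :=
  ∑ b ∈ Finset.univ.filter (fun b => p.1 b < p.1 a), lam b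

/-- `x^b_a`: the left endpoint of the interval of the letter `a` after the exchange. -/
def leftBot {A : Type*} [Fintype A] {d : ℕ} (p : (A ≃ Fin d) × (A ≃ Fin d))
    (lam : A → ℝ) (a : A) : ℝ :=
  ∑ b ∈ Finset.univ.filter (fun b => p.2 b < p.2 a), lam b

open Classical in
/-- The interval exchange transformation `T(π̃, λ)`, extended by the identity outside
the union of the intervals `[x^t_a, x^t_a + λ_a)`. -/
noncomputable def iet {A : Type*} [Fintype A] {d : ℕ}
    (p : (A ≃ Fin d) × (A ≃ Fin d)) (lam : A → ℝ) : ℝ → ℝ := fun x =>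
  if h : ∃ a : A, leftTop p lam a ≤ x ∧ x < leftTop p lam a + lam a then
    x - leftTop p lam h.choose + leftBot p lam h.choose
  else x

section LabeledOrder

variable {A : Type*} {d : ℕ}

theorem lt_last_of_ne (e : A ≃ Fin d) {last : Fin d} (hlast : (last : ℕ) + 1 = d) {a : A}
    (ha : a ≠ e.symm last) : e a < e (e.symm last) := by
  have h : e a ≠ last := fun h => ha (by rw [← h, e.symm_apply_apply])
  rw [e.apply_symm_apply]
  have := Fin.val_ne_of_ne h
  rw [Fin.lt_def]
  omega

theorem winner_reduced_pos {lam lam' : A → ℝ} (hlam : ∀ a, 0 < lam a) {w f : A}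
    (hlt : lam f < lam w) (hw : lam' w = lam w - lam f)
    (hne : ∀ a, a ≠ w → lam' a = lam a) (a : A) : 0 < lam' a := by
  by_cases h : a = w
  · subst h; linarith
  · rw [hne a h]; exact hlam a

/-- `e'` is obtained from `e` by moving the letter in last position right after `w`. -/
def MovesLastAfter (e e' : A ≃ Fin d) (w : A) (last : Fin d) : Prop :=
  ∀ j : Fin d,
    ((j : ℕ) ≤ (e w : ℕ) → e'.symm j = e.symm j) ∧
    ((j : ℕ) = (e w : ℕ) + 1 → e'.symm j = e.symm last) ∧
    ((e w : ℕ) + 1 < (j : ℕ) → ∀ i : Fin d, (i : ℕ) + 1 = (j : ℕ) → e'.symm j = e.symm i)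

namespace MovesLastAfter

variable {e e' : A ≃ Fin d} {w : A} {last : Fin d}

theorem apply_of_le (h : MovesLastAfter e e' w last) {a : A} (ha : (e a : ℕ) ≤ e w) :
    (e' a : ℕ) = e a := by
  have := (h (e a)).1 ha
  rw [e.symm_apply_apply, Equiv.symm_apply_eq] at this
  rw [← this]

theorem apply_last (h : MovesLastAfter e e' w last) (hlast : (last : ℕ) + 1 = d)
    (hw : w ≠ e.symm last) : (e' (e.symm last) : ℕ) = e w + 1 := by
  have hlt := lt_last_of_ne e hlast hw
  rw [e.apply_symm_apply, Fin.lt_def] at hlt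
  have := (h ⟨e w + 1, by omega⟩).2.1 rfl
  rw [Equiv.symm_apply_eq] at this
  rw [← this]

theorem apply_of_gt (h : MovesLastAfter e e' w last) (hlast : (last : ℕ) + 1 = d)
    {a : A} (ha : (e w : ℕ) < e a) (hne : a ≠ e.symm last) : (e' a : ℕ) = e a + 1 := by
  have hlt := lt_last_of_ne e hlast hne
  rw [e.apply_symm_apply, Fin.lt_def] at hlt
  have := (h ⟨e a + 1, by omega⟩).2.2 (by simpa using ha) (e a) rfl
  rw [e.symm_apply_apply, Equiv.symm_apply_eq] at this
  rw [← this]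

end MovesLastAfter

end LabeledOrder

/-- The first return of `f` to `[0, c)` at `x` happens at time at most two and equals `y`. -/
theorem firstReturn_of_or {f : ℝ → ℝ} {c x y : ℝ} (hy : 0 ≤ y ∧ y < c)
    (h : f x = y ∨ (c ≤ f x ∧ f (f x) = y)) :
    ∃ m : ℕ, 1 ≤ m ∧ m ≤ 2 ∧ (0 ≤ f^[m] x ∧ f^[m] x < c) ∧
      (∀ m' : ℕ, 1 ≤ m' → m' < m → ¬(0 ≤ f^[m'] x ∧ f^[m'] x < c)) ∧ f^[m] x = y := by
  rcases h with h | ⟨hc, h⟩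
  · exact ⟨1, le_rfl, one_le_two, by simpa [h] using hy, fun m' _ _ => by omega, by simpa using h⟩
  · refine ⟨2, one_le_two, le_rfl, by simpa [h] using hy, fun m' h₁ h₂ => ?_, by simpa using h⟩
    obtain rfl : m' = 1 := by omega
    simpa using fun _ => hc

/-- The left endpoint of the interval of `a` when intervals of lengths `lam` are laid out in the
order prescribed by `e`. -/
noncomputable def leftEnd {A : Type*} [Fintype A] {d : ℕ} (e : A ≃ Fin d) (lam : A → ℝ)
    (a : A) : ℝ :=
  ∑ b, if e b < e a then lam b else 0

section LeftEnd

variable {A : Type*} [Fintype A] {d : ℕ}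

theorem leftTop_eq_leftEnd (p : (A ≃ Fin d) × (A ≃ Fin d)) (lam : A → ℝ) (a : A) :
    leftTop p lam a = leftEnd p.1 lam a := by
  simp [leftTop, leftEnd, Finset.sum_filter]

theorem leftBot_eq_leftEnd (p : (A ≃ Fin d) × (A ≃ Fin d)) (lam : A → ℝ) (a : A) :
    leftBot p lam a = leftEnd p.2 lam a := by
  simp [leftBot, leftEnd, Finset.sum_filter]

theorem leftEnd_nonneg (e : A ≃ Fin d) {lam : A → ℝ} (hlam : ∀ a, 0 < lam a) (a : A) :
    0 ≤ leftEnd e lam a := by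
  refine Finset.sum_nonneg fun b _ => ?_
  split_ifs
  · exact (hlam b).le
  · exact le_rfl

theorem leftEnd_add_eq (e : A ≃ Fin d) (lam : A → ℝ) (a : A) :
    leftEnd e lam a + lam a = ∑ b, if e b ≤ e a then lam b else 0 := by
  classical
  have h : lam a = ∑ b, if b = a then lam b else 0 := by simp
  rw [leftEnd, h, ← Finset.sum_add_distrib]
  refine Finset.sum_congr rfl fun b _ => ?_
  have hinj : e b = e a ↔ b = a := e.injective.eq_iff
  rcases lt_trichotomy (e b) (e a) with hlt | heq | hgt
  · have : b ≠ a := fun h => hlt.ne (hinj.2 h)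
    simp [hlt, hlt.le, this]
  · obtain rfl := hinj.1 heq
    simp
  · have : b ≠ a := fun h => hgt.ne' (hinj.2 h)
    simp [hgt.not_gt, hgt.not_ge, this]

theorem leftEnd_add_le (e : A ≃ Fin d) {lam : A → ℝ} (hlam : ∀ a, 0 < lam a) {a b : A}
    (hab : e a < e b) : leftEnd e lam a + lam a ≤ leftEnd e lam b := by
  rw [leftEnd_add_eq, leftEnd]
  refine Finset.sum_le_sum fun c _ => ?_
  have := hlam c
  split_ifs with h₁ h₂
  · exact le_rfl
  · exact absurd (h₁.trans_lt hab) h₂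
  · exact this.le
  · exact le_rfl

theorem leftEnd_last (e : A ≃ Fin d) (lam : A → ℝ) {last : Fin d} (hlast : (last : ℕ) + 1 = d) :
    leftEnd e lam (e.symm last) + lam (e.symm last) = ∑ a, lam a := by
  rw [leftEnd_add_eq]
  refine Finset.sum_congr rfl fun b _ => if_pos ?_
  rw [e.apply_symm_apply, Fin.le_def]
  omega

theorem leftEnd_mem_unique (e : A ≃ Fin d) {lam : A → ℝ} (hlam : ∀ a, 0 < lam a) {a b : A} {x : ℝ}
    (ha : leftEnd e lam a ≤ x ∧ x < leftEnd e lam a + lam a)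
    (hb : leftEnd e lam b ≤ x ∧ x < leftEnd e lam b + lam b) : a = b := by
  rcases lt_trichotomy (e a) (e b) with h | h | h
  · linarith [leftEnd_add_le e hlam h]
  · exact e.injective h
  · linarith [leftEnd_add_le e hlam h]

theorem exists_mem_leftEnd (e : A ≃ Fin d) (lam : A → ℝ) {x : ℝ}
    (hx0 : 0 ≤ x) (hx : x < ∑ a, lam a) :
    ∃ a, leftEnd e lam a ≤ x ∧ x < leftEnd e lam a + lam a := by
  have key : ∀ n ≤ d, x < (∑ b, if (e b : ℕ) < n then lam b else 0) →
      ∃ a, leftEnd e lam a ≤ x ∧ x < leftEnd e lam a + lam a := by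
    intro n
    induction n with
    | zero => intro _ h; simp at h; linarith
    | succ n ih =>
      intro hn h
      by_cases hlt : x < ∑ b, if (e b : ℕ) < n then lam b else 0
      · exact ih (by omega) hlt
      · refine ⟨e.symm ⟨n, hn⟩, ?_, ?_⟩
        · simpa [leftEnd, Fin.lt_def] using hlt
        · rw [leftEnd_add_eq]
          simpa [Fin.le_def, Nat.lt_succ_iff] using h
  exact key d le_rfl (by simpa using hx)

theorem iet_apply (p : (A ≃ Fin d) × (A ≃ Fin d)) {lam : A → ℝ} (hlam : ∀ a, 0 < lam a)
    {a : A} {x : ℝ} (h₁ : leftEnd p.1 lam a ≤ x) (h₂ : x < leftEnd p.1 lam a + lam a) :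
    iet p lam x = x - leftEnd p.1 lam a + leftEnd p.2 lam a := by
  have h : ∃ a : A, leftTop p lam a ≤ x ∧ x < leftTop p lam a + lam a :=
    ⟨a, by simpa only [leftTop_eq_leftEnd] using ⟨h₁, h₂⟩⟩
  have hs := h.choose_spec
  rw [leftTop_eq_leftEnd] at hs
  rw [iet, dif_pos h, leftTop_eq_leftEnd, leftBot_eq_leftEnd,
    leftEnd_mem_unique p.1 hlam hs ⟨h₁, h₂⟩]

theorem leftEnd_congr_of_last (e : A ≃ Fin d) {last : Fin d} (hlast : (last : ℕ) + 1 = d)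
    {lam lam' : A → ℝ} (h : ∀ a, a ≠ e.symm last → lam' a = lam a) (a : A) :
    leftEnd e lam' a = leftEnd e lam a := by
  refine Finset.sum_congr rfl fun b _ => ?_
  split_ifs with hb
  · refine h b ?_
    rintro rfl
    rw [e.apply_symm_apply, Fin.lt_def] at hb
    omega
  · rfl

/-- A Rauzy move with winner `w` and loser `f` shortens the total length by that of `f`. -/
theorem sum_winner_reduced {lam lam' : A → ℝ} {w f : A} (hw : lam' w = lam w - lam f)
    (hne : ∀ a, a ≠ w → lam' a = lam a) : ∑ a, lam' a = (∑ a, lam a) - lam f := by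
  classical
  have : ∀ a, lam' a = lam a - if a = w then lam f else 0 := by
    intro a
    by_cases h : a = w
    · subst h; simp [hw]
    · simp [h, hne a h]
  simp [this, Finset.sum_sub_distrib]

namespace MovesLastAfter

variable {e e' : A ≃ Fin d} {w : A} {last : Fin d}

theorem leftEnd_of_ne (h : MovesLastAfter e e' w last) (hlast : (last : ℕ) + 1 = d)
    (hw : w ≠ e.symm last) {lam lam' : A → ℝ} (hlw : lam' w = lam w - lam (e.symm last))
    (hlne : ∀ a, a ≠ w → lam' a = lam a) {a : A} (ha : a ≠ e.symm last) :
    leftEnd e' lam' a = leftEnd e lam a := by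
  classical
  have hterm : ∀ b, (if e' b < e' a then lam' b else 0) =
      (if e b < e a then lam b else 0)
        + (if b = e.symm last then (if e w < e a then lam (e.symm last) else 0) else 0)
        - (if b = w then (if e w < e a then lam (e.symm last) else 0) else 0) := by
    intro b
    have hal := lt_last_of_ne e hlast ha
    have h1 {c : A} (hc : (e c : ℕ) ≤ e w) := h.apply_of_le hc
    have h2 := h.apply_last hlast hw
    have h3 {c : A} (hc : (e w : ℕ) < e c) (hcl : c ≠ e.symm last) :=
      h.apply_of_gt hlast hc hcl
    have ha' : (e' a < e' (e.symm last) ↔ e a ≤ e w) ∧ e' a ≠ e' (e.symm last) := by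
      refine ⟨?_, fun hh => ha (e'.injective hh)⟩
      rw [Fin.lt_def, Fin.le_def]
      rcases le_or_gt (e a : ℕ) (e w) with hk | hk
      · have := h1 hk; omega
      · have := h3 hk ha; omega
    by_cases hb : b = e.symm last
    · subst hb
      have hn : ¬ e (e.symm last) < e a := hal.not_gt
      have hiff : e' (e.symm last) < e' a ↔ e w < e a := by
        rw [← not_le, ← not_le, ← ha'.1, not_iff_not]
        exact ⟨fun hh => lt_of_le_of_ne hh ha'.2, le_of_lt⟩
      simp only [hn, hiff, hlne _ (Ne.symm hw), Ne.symm hw, if_true, if_false, zero_add, sub_zero]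
    · have hiff : e' b < e' a ↔ e b < e a := by
        rw [Fin.lt_def, Fin.lt_def]
        rcases le_or_gt (e a : ℕ) (e w) with hk | hk <;>
        rcases le_or_gt (e b : ℕ) (e w) with hl | hl
        · rw [h1 hk, h1 hl]
        · rw [h1 hk, h3 hl hb]; omega
        · rw [h3 hk ha, h1 hl]; omega
        · rw [h3 hk ha, h3 hl hb]; omega
      by_cases hbw : b = w
      · subst hbw
        simp only [hiff, hb, if_true, if_false, hlw]
        split_ifs <;> ring
      · simp [hiff, hb, hbw, hlne b hbw]
  simp only [leftEnd, hterm, Finset.sum_sub_distrib, Finset.sum_add_distrib]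
  simp

theorem leftEnd_last_eq (h : MovesLastAfter e e' w last) (hlast : (last : ℕ) + 1 = d)
    (hw : w ≠ e.symm last) {lam lam' : A → ℝ} (hlw : lam' w = lam w - lam (e.symm last))
    (hlne : ∀ a, a ≠ w → lam' a = lam a) :
    leftEnd e' lam' (e.symm last) = leftEnd e lam w + lam w - lam (e.symm last) := by
  have hsum : leftEnd e' lam' (e.symm last) = leftEnd e' lam' w + lam' w := by
    rw [leftEnd_add_eq, leftEnd]
    refine Finset.sum_congr rfl fun b _ => if_congr ?_ rfl rfl
    rw [Fin.lt_def, Fin.le_def, h.apply_last hlast hw, h.apply_of_le le_rfl]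
    omega
  rw [hsum, h.leftEnd_of_ne hlast hw hlw hlne hw, hlw]
  ring

end MovesLastAfter

/-- The image of an interval exchange stays in its domain. -/
theorem iet_mem (p : (A ≃ Fin d) × (A ≃ Fin d)) {lam : A → ℝ} (hlam : ∀ a, 0 < lam a)
    {x : ℝ} (hx0 : 0 ≤ x) (hx : x < ∑ a, lam a) :
    0 ≤ iet p lam x ∧ iet p lam x < ∑ a, lam a := by
  obtain ⟨a, ha₁, ha₂⟩ := exists_mem_leftEnd p.1 lam hx0 hx
  rw [iet_apply p hlam ha₁ ha₂]
  have h₁ := leftEnd_nonneg p.2 hlam a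
  have h₂ : leftEnd p.2 lam a + lam a ≤ ∑ b, lam b := by
    rw [leftEnd_add_eq]
    refine Finset.sum_le_sum fun b _ => ?_
    split_ifs
    · exact le_rfl
    · exact (hlam b).le
  constructor <;> linarith

theorem iet_return_top (p p' : (A ≃ Fin d) × (A ≃ Fin d)) {last : Fin d}
    (hlast : (last : ℕ) + 1 = d) {lam lam' : A → ℝ} (hlam : ∀ a, 0 < lam a)
    (hstep : labStepT p p') (hlt : lam (p.2.symm last) < lam (p.1.symm last))
    (hw : lam' (p.1.symm last) = lam (p.1.symm last) - lam (p.2.symm last))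
    (hne : ∀ a, a ≠ p.1.symm last → lam' a = lam a) {x : ℝ} (hx0 : 0 ≤ x)
    (hx : x < ∑ a, lam' a) :
    iet p lam x = iet p' lam' x ∨
      ((∑ a, lam a) - lam (p.2.symm last) ≤ iet p lam x ∧
        iet p lam (iet p lam x) = iet p' lam' x) := by
  obtain ⟨hwf, hp, hmove⟩ := hstep last hlast
  change MovesLastAfter p.2 p'.2 (p.1.symm last) last at hmove
  have hlam' := winner_reduced_pos hlam hlt hw hne
  obtain ⟨a, ha₁, ha₂⟩ := exists_mem_leftEnd p'.1 lam' hx0 hx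
  rw [iet_apply p' hlam' ha₁ ha₂]
  rw [hp, leftEnd_congr_of_last p.1 hlast hne] at *
  have hle : lam' a ≤ lam a := by
    by_cases h : a = p.1.symm last
    · subst h; linarith [hlam (p.2.symm last)]
    · exact (hne a h).le
  have hTx := iet_apply p hlam ha₁ (by linarith)
  by_cases ha : a = p.2.symm last
  · right
    subst ha
    rw [hne _ hwf.symm] at ha₂
    rw [hmove.leftEnd_last_eq hlast hwf hw hne]
    have htop := leftEnd_last p.1 lam hlast
    have hbot := leftEnd_last p.2 lam hlast
    have hT2 := iet_apply p hlam (a := p.1.symm last) (x := iet p lam x)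
      (by linarith) (by linarith)
    constructor <;> linarith
  · left
    rw [hmove.leftEnd_of_ne hlast hwf hw hne ha, hTx]

theorem iet_return_bot (p p' : (A ≃ Fin d) × (A ≃ Fin d)) {last : Fin d}
    (hlast : (last : ℕ) + 1 = d) {lam lam' : A → ℝ} (hlam : ∀ a, 0 < lam a)
    (hstep : labStepB p p') (hlt : lam (p.1.symm last) < lam (p.2.symm last))
    (hw : lam' (p.2.symm last) = lam (p.2.symm last) - lam (p.1.symm last))
    (hne : ∀ a, a ≠ p.2.symm last → lam' a = lam a) {x : ℝ} (hx0 : 0 ≤ x)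
    (hx : x < ∑ a, lam' a) :
    iet p lam x = iet p' lam' x ∨
      ((∑ a, lam a) - lam (p.1.symm last) ≤ iet p lam x ∧
        iet p lam (iet p lam x) = iet p' lam' x) := by
  obtain ⟨hfw, hp, hmove⟩ := hstep last hlast
  change MovesLastAfter p.1 p'.1 (p.2.symm last) last at hmove
  have hlam' := winner_reduced_pos hlam hlt hw hne
  obtain ⟨a, ha₁, ha₂⟩ := exists_mem_leftEnd p'.1 lam' hx0 hx
  rw [iet_apply p' hlam' ha₁ ha₂, hp, leftEnd_congr_of_last p.2 hlast hne]
  have hle : lam' a ≤ lam a := by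
    by_cases h : a = p.2.symm last
    · subst h; linarith [hlam (p.1.symm last)]
    · exact (hne a h).le
  by_cases ha : a = p.1.symm last
  · right
    subst ha
    rw [hne _ hfw] at ha₂
    rw [hmove.leftEnd_last_eq hlast hfw.symm hw hne] at *
    have htop := leftEnd_last p.1 lam hlast
    have hbot := leftEnd_last p.2 lam hlast
    have hTx := iet_apply p hlam (a := p.2.symm last) (x := x) (by linarith) (by linarith)
    have hT2 := iet_apply p hlam (a := p.1.symm last) (x := iet p lam x)
      (by linarith) (by linarith)
    constructor <;> linarith
  · left
    rw [hmove.leftEnd_of_ne hlast hfw.symm hw hne ha] at *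
    exact iet_apply p hlam ha₁ (by linarith)

end LeftEnd

/-- Rauzy–Veech induction as a first return map.  Let `π̃` be a labeled permutation on
an alphabet of cardinality `d ≥ 2` with `π_t⁻¹(d) ≠ π_b⁻¹(d)`, and let `λ` have
positive coordinates, `T = T(π̃, λ)` on `I = [0, L)`, `L = Σ λ`.
If `T` has type `t` (`λ_{π_t⁻¹(d)} > λ_{π_b⁻¹(d)}`) then, with
`J = [0, L - λ_{π_b⁻¹(d)})` and `λ'` obtained from `λ` by replacing `λ_{π_t⁻¹(d)}` with
`λ_{π_t⁻¹(d)} - λ_{π_b⁻¹(d)}`, for every `x ∈ J` outside a finite set there is a least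
`m ≥ 1` (in fact `m ≤ 2`) with `T^m(x) ∈ J`, and `T^m(x) = T(𝓡_t(π̃), λ')(x)`.
The symmetric statement holds when `T` has type `b`. -/
theorem iet_first_return_rauzy {A : Type*} [Fintype A] (d : ℕ) (hd : 2 ≤ d)
    (p : (A ≃ Fin d) × (A ≃ Fin d)) (last : Fin d) (hlast : (last : ℕ) + 1 = d)
    (hne : p.1.symm last ≠ p.2.symm last)
    (lam : A → ℝ) (hlam : ∀ a, 0 < lam a) :
    (∀ (p' : (A ≃ Fin d) × (A ≃ Fin d)) (lam' : A → ℝ),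
      labStepT p p' →
      lam (p.2.symm last) < lam (p.1.symm last) →
      lam' (p.1.symm last) = lam (p.1.symm last) - lam (p.2.symm last) →
      (∀ a, a ≠ p.1.symm last → lam' a = lam a) →
      ∃ E : Set ℝ, E.Finite ∧
        ∀ x : ℝ, 0 ≤ x → x < (∑ a, lam a) - lam (p.2.symm last) → x ∉ E →
          ∃ m : ℕ, 1 ≤ m ∧ m ≤ 2 ∧
            (0 ≤ (iet p lam)^[m] x ∧
              (iet p lam)^[m] x < (∑ a, lam a) - lam (p.2.symm last)) ∧
            (∀ m' : ℕ, 1 ≤ m' → m' < m →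
              ¬(0 ≤ (iet p lam)^[m'] x ∧
                (iet p lam)^[m'] x < (∑ a, lam a) - lam (p.2.symm last))) ∧
            (iet p lam)^[m] x = iet p' lam' x) ∧
    (∀ (p' : (A ≃ Fin d) × (A ≃ Fin d)) (lam' : A → ℝ),
      labStepB p p' →
      lam (p.1.symm last) < lam (p.2.symm last) →
      lam' (p.2.symm last) = lam (p.2.symm last) - lam (p.1.symm last) →
      (∀ a, a ≠ p.2.symm last → lam' a = lam a) →
      ∃ E : Set ℝ, E.Finite ∧
        ∀ x : ℝ, 0 ≤ x → x < (∑ a, lam a) - lam (p.1.symm last) → x ∉ E →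
          ∃ m : ℕ, 1 ≤ m ∧ m ≤ 2 ∧
            (0 ≤ (iet p lam)^[m] x ∧
              (iet p lam)^[m] x < (∑ a, lam a) - lam (p.1.symm last)) ∧
            (∀ m' : ℕ, 1 ≤ m' → m' < m →
              ¬(0 ≤ (iet p lam)^[m'] x ∧
                (iet p lam)^[m'] x < (∑ a, lam a) - lam (p.1.symm last))) ∧
            (iet p lam)^[m] x = iet p' lam' x) := by
  refine ⟨fun p' lam' hstep hlt hw hne' => ⟨∅, Set.finite_empty, fun x hx0 hx _ => ?_⟩,
    fun p' lam' hstep hlt hw hne' => ⟨∅, Set.finite_empty, fun x hx0 hx _ => ?_⟩⟩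
  all_goals
    have hsum := sum_winner_reduced hw hne'
    have hmem := iet_mem p' (winner_reduced_pos hlam hlt hw hne') hx0 (hsum ▸ hx)
    rw [hsum] at hmem
  · exact firstReturn_of_or hmem
      (iet_return_top p p' hlast hlam hstep hlt hw hne' hx0 (hsum ▸ hx))
  · exact firstReturn_of_or hmem
      (iet_return_bot p p' hlast hlam hstep hlt hw hne' hx0 (hsum ▸ hx))
end

section
/- Let π̃ = (π_t, π_b) be a labeled permutation on an alphabet 𝒜 of cardinality d ≥ 2 with π_t⁻¹(d) ≠ π_b⁻¹(d), and let τ ∈ Θ(π̃) be a suspension datum for π̃. Define τ′ ∈ ℝ^𝒜 by τ′_{π_t⁻¹(d)} = τ_{π_t⁻¹(d)} − τ_{π_b⁻¹(d)} and τ′_α = τ_α for α ≠ π_t⁻¹(d). Then τ′ is a suspension datum for 𝓡_t(π̃), i.e. τ′ ∈ Θ(𝓡_t(π̃)). Symmetrically, defining τ″ ∈ ℝ^𝒜 by τ″_{π_b⁻¹(d)} = τ_{π_b⁻¹(d)} − τ_{π_t⁻¹(d)} and τ″_α = τ_α for α ≠ π_b⁻¹(d), one has τ″ ∈ Θ(𝓡_b(π̃)).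 (Thus the Rauzy–Veech induction is well defined on suspension data.) -/
/-- The set `Θ(π̃)` of suspension data for a labeled permutation `π̃`. -/
def suspSet {A : Type*} [Fintype A] {d : ℕ} (p : (A ≃ Fin d) × (A ≃ Fin d)) :
    Set (A → ℝ) :=
  {τ | ∀ k : ℕ, 1 ≤ k → k ≤ d - 1 →
    0 < ∑ a ∈ Finset.univ.filter (fun a => (p.1 a : ℕ) < k), τ a ∧
    ∑ a ∈ Finset.univ.filter (fun a => (p.2 a : ℕ) < k), τ a < 0}

/-- Changing `τ` at the letter `α` by `-c` changes a finite sum by `-c` iff `α` is a summand. -/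
lemma sum_eq_sub_ite_of_eq_off {A : Type*} [DecidableEq A] (s : Finset A) {α : A} {c : ℝ}
    {τ τ' : A → ℝ} (hα : τ' α = τ α - c) (hoff : ∀ a, a ≠ α → τ' a = τ a) :
    ∑ a ∈ s, τ' a = ∑ a ∈ s, τ a - if α ∈ s then c else 0 := by
  have h : ∀ a, τ' a = τ a - if a = α then c else 0 := by
    intro a
    by_cases ha : a = α
    · subst ha; simpa using hα
    · simp [ha, hoff a ha]
  simp_rw [h, Finset.sum_sub_distrib, Finset.sum_ite_eq']

/-- The sum over all letters but the last one is the total minus the last term. -/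
lemma sum_filter_lt_last {A : Type*} [Fintype A] {d : ℕ} (q : A ≃ Fin d) {last : Fin d}
    (hlast : (last : ℕ) + 1 = d) (τ : A → ℝ) :
    ∑ a ∈ Finset.univ.filter (fun a => (q a : ℕ) < d - 1), τ a
      = ∑ a, τ a - τ (q.symm last) := by
  classical
  have h : Finset.univ.filter (fun a => (q a : ℕ) < d - 1)
      = Finset.univ.erase (q.symm last) := by
    ext a
    have := (q a).isLt
    simp only [Finset.mem_filter, Finset.mem_univ, true_and, Finset.mem_erase, and_true, ne_eq,
      Equiv.eq_symm_apply, Fin.ext_iff]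
    omega
  rw [h, Finset.sum_erase_eq_sub (Finset.mem_univ _)]

/-- On a suspension datum, the last top letter has a smaller value than the last bottom letter. -/
lemma last_top_lt_last_bottom {A : Type*} [Fintype A] {d : ℕ} (hd : 2 ≤ d)
    {p : (A ≃ Fin d) × (A ≃ Fin d)} {last : Fin d} (hlast : (last : ℕ) + 1 = d)
    {τ : A → ℝ} (hτ : τ ∈ suspSet p) : τ (p.1.symm last) < τ (p.2.symm last) := by
  have h := hτ (d - 1) (by omega) le_rfl
  rw [sum_filter_lt_last p.1 hlast, sum_filter_lt_last p.2 hlast] at h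
  linarith [h.1, h.2]

/-- Modifying `τ` at the last letter of a row does not change the proper prefix sums. -/
lemma prefix_sum_congr_of_eq_off_last {A : Type*} [Fintype A] {d : ℕ} (q : A ≃ Fin d)
    {last : Fin d} (hlast : (last : ℕ) + 1 = d) {τ τ' : A → ℝ}
    (hoff : ∀ a, a ≠ q.symm last → τ' a = τ a) {k : ℕ} (hk : k ≤ d - 1) :
    ∑ a ∈ Finset.univ.filter (fun a => (q a : ℕ) < k), τ' a
      = ∑ a ∈ Finset.univ.filter (fun a => (q a : ℕ) < k), τ a := by
  refine Finset.sum_congr rfl fun a ha => hoff a ?_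
  rintro rfl
  simp only [Finset.mem_filter, Equiv.apply_symm_apply] at ha
  omega

/-- The prefix sums of the row changed by a Rauzy move stay negative. -/
lemma prefix_sum_neg_of_rauzy_move {A : Type*} [Fintype A] {d : ℕ} {q q' : A ≃ Fin d}
    {last : Fin d} (hlast : (last : ℕ) + 1 = d) {α : A} (hα : α ≠ q.symm last)
    (hmove : ∀ j : Fin d,
      ((j : ℕ) ≤ (q α : ℕ) → q'.symm j = q.symm j) ∧
      ((j : ℕ) = (q α : ℕ) + 1 → q'.symm j = q.symm last) ∧
      ((q α : ℕ) + 1 < (j : ℕ) → ∀ i : Fin d, (i : ℕ) + 1 = (j : ℕ) → q'.symm j = q.symm i))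
    {τ τ' : A → ℝ} (hτα : τ' α = τ α - τ (q.symm last))
    (hoff : ∀ a, a ≠ α → τ' a = τ a) (hlt : τ α < τ (q.symm last))
    (hneg : ∀ k : ℕ, 1 ≤ k → k ≤ d - 1 →
      ∑ a ∈ Finset.univ.filter (fun a => (q a : ℕ) < k), τ a < 0)
    {k : ℕ} (hk : 1 ≤ k) (hkd : k ≤ d - 1) :
    ∑ a ∈ Finset.univ.filter (fun a => (q' a : ℕ) < k), τ' a < 0 := by
  classical
  have hαlast : (q α : ℕ) < last := by
    have h1 := (q α).isLt
    have h2 : (q α : ℕ) ≠ last := by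
      rwa [ne_eq, Equiv.eq_symm_apply, Fin.ext_iff] at hα
    omega
  have hlow : ∀ a, (q a : ℕ) ≤ q α → (q' a : ℕ) = q a := by
    intro a ha
    have h := (hmove (q a)).1 ha
    rw [Equiv.symm_apply_apply, Equiv.symm_apply_eq] at h
    rw [← h]
  have hloser : (q' (q.symm last) : ℕ) = q α + 1 := by
    have h := (hmove ⟨q α + 1, by omega⟩).2.1 rfl
    rw [Equiv.symm_apply_eq] at h
    rw [← h]
  have hhigh : ∀ a, (q α : ℕ) < q a → a ≠ q.symm last → (q' a : ℕ) = q a + 1 := by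
    intro a ha hne
    rw [ne_eq, Equiv.eq_symm_apply, Fin.ext_iff] at hne
    have hlt := (q a).isLt
    have h := (hmove ⟨q a + 1, by omega⟩).2.2 (by simpa using ha) (q a) rfl
    rw [Equiv.symm_apply_apply, Equiv.symm_apply_eq] at h
    rw [← h]
  rw [sum_eq_sub_ite_of_eq_off _ hτα hoff]
  simp only [Finset.mem_filter, Finset.mem_univ, true_and, hlow α le_rfl]
  have hpos : ∀ a, ((q a : ℕ) ≤ q α ∧ (q' a : ℕ) = q a) ∨
      (a = q.symm last ∧ (q' a : ℕ) = q α + 1) ∨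
      ((q α : ℕ) < q a ∧ a ≠ q.symm last ∧ (q' a : ℕ) = q a + 1) := by
    intro a
    rcases le_or_gt (q a : ℕ) (q α) with h | h
    · exact Or.inl ⟨h, hlow a h⟩
    · by_cases ha : a = q.symm last
      · exact Or.inr (Or.inl ⟨ha, ha ▸ hloser⟩)
      · exact Or.inr (Or.inr ⟨h, ha, hhigh a h ha⟩)
  have hqlast : (q (q.symm last) : ℕ) = last := by simp
  rcases le_or_gt k (q α + 1 : ℕ) with hle | hgt
  · have hset : Finset.univ.filter (fun a => (q' a : ℕ) < k)
        = Finset.univ.filter (fun a => (q a : ℕ) < k) := by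
      refine Finset.filter_congr fun a _ => ?_
      rcases hpos a with h | ⟨rfl, h⟩ | h <;> omega
    rw [hset]
    rcases Nat.lt_or_ge (q α) k with hαk | hαk
    · obtain rfl : k = q α + 1 := by omega
      have hins : Finset.univ.filter (fun a => (q a : ℕ) < q α + 1)
          = insert α (Finset.univ.filter (fun a => (q a : ℕ) < q α)) := by
        ext a
        have : a = α ↔ (q a : ℕ) = q α := by rw [← Fin.ext_iff, q.apply_eq_iff_eq]
        simp only [Finset.mem_filter, Finset.mem_univ, true_and, Finset.mem_insert, this]
        omega
      rw [if_pos hαk, hins, Finset.sum_insert (by simp)]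
      rcases Nat.eq_zero_or_pos (q α : ℕ) with h0 | h0
      · simp only [h0, Nat.not_lt_zero, Finset.filter_false, Finset.sum_empty]
        linarith
      · linarith [hneg (q α) h0 (by omega)]
    · rw [if_neg (by omega), sub_zero]
      exact hneg k hk hkd
  · have hins : Finset.univ.filter (fun a => (q' a : ℕ) < k)
        = insert (q.symm last) (Finset.univ.filter (fun a => (q a : ℕ) < k - 1)) := by
      ext a
      simp only [Finset.mem_filter, Finset.mem_univ, true_and, Finset.mem_insert]
      rcases hpos a with h | ⟨rfl, h⟩ | ⟨h, hne, h'⟩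
      · have hne : a ≠ q.symm last := by rintro rfl; omega
        simp only [hne, false_or]
        omega
      · simp only [true_or, iff_true]
        omega
      · simp only [hne, false_or]
        omega
    rw [if_pos (by omega), hins, Finset.sum_insert (by simp; omega)]
    linarith [hneg (k - 1) (by omega) (by omega)]

/-- Rauzy–Veech induction is well defined on suspension data: if `τ ∈ Θ(π̃)` and
`π_t⁻¹(d) ≠ π_b⁻¹(d)`, then `τ'`, obtained from `τ` by replacing `τ_{π_t⁻¹(d)}` with
`τ_{π_t⁻¹(d)} - τ_{π_b⁻¹(d)}`, is a suspension datum for `𝓡_t(π̃)`; symmetrically,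
`τ''`, obtained by replacing `τ_{π_b⁻¹(d)}` with `τ_{π_b⁻¹(d)} - τ_{π_t⁻¹(d)}`,
is a suspension datum for `𝓡_b(π̃)`. -/
theorem suspSet_rauzy_step {A : Type*} [Fintype A] (d : ℕ) (hd : 2 ≤ d)
    (p : (A ≃ Fin d) × (A ≃ Fin d)) (last : Fin d) (hlast : (last : ℕ) + 1 = d)
    (hne : p.1.symm last ≠ p.2.symm last)
    (τ : A → ℝ) (hτ : τ ∈ suspSet p) :
    (∀ (p' : (A ≃ Fin d) × (A ≃ Fin d)) (τ' : A → ℝ),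
      labStepT p p' →
      τ' (p.1.symm last) = τ (p.1.symm last) - τ (p.2.symm last) →
      (∀ a, a ≠ p.1.symm last → τ' a = τ a) →
      τ' ∈ suspSet p') ∧
    (∀ (p' : (A ≃ Fin d) × (A ≃ Fin d)) (τ'' : A → ℝ),
      labStepB p p' →
      τ'' (p.2.symm last) = τ (p.2.symm last) - τ (p.1.symm last) →
      (∀ a, a ≠ p.2.symm last → τ'' a = τ a) →
      τ'' ∈ suspSet p') := by
  have hlt := last_top_lt_last_bottom hd hlast hτ
  refine ⟨fun p' τ' hstep hval hoff k hk hkd => ?_, fun p' τ'' hstep hval hoff k hk hkd => ?_⟩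
  · obtain ⟨-, hrow, hmove⟩ := hstep last hlast
    refine ⟨?_, ?_⟩
    · rw [hrow, prefix_sum_congr_of_eq_off_last p.1 hlast hoff hkd]
      exact (hτ k hk hkd).1
    · exact prefix_sum_neg_of_rauzy_move hlast hne hmove hval hoff hlt
        (fun k hk hkd => (hτ k hk hkd).2) hk hkd
  · obtain ⟨-, hrow, hmove⟩ := hstep last hlast
    refine ⟨?_, ?_⟩
    · have h := prefix_sum_neg_of_rauzy_move (τ := fun a => -τ a) (τ' := fun a => -τ'' a)
        hlast hne.symm hmove (by simp only [hval]; ring) (fun a ha => by simp only [hoff a ha])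
        (neg_lt_neg hlt)
        (fun k hk hkd => by simpa [Finset.sum_neg_distrib] using (hτ k hk hkd).1) hk hkd
      simpa [Finset.sum_neg_distrib] using h
    · rw [hrow, prefix_sum_congr_of_eq_off_last p.2 hlast hoff hkd]
      exact (hτ k hk hkd).2
end
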